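/- Let s ≥ 0, λ ∈ ℝ, let V : (0,∞) → ℝ be continuously differentiable, and let u be a twice continuously differentiable real-valued function of (t,r) on an open subset Ω of ℝ × (0,∞). Define τ₊ = 2+t+r, τ₋ = 2+t−r, ∇₊u = ∂_t u + ∂_r u, ∇₋u = ∂_t u − ∂_r u, M(u) = τ₊^{s} ∇₊u + τ₋^{s} ∇₋u, X₊(u) = (1/2) τ₋^{s} (∇₋u)² + (1/2) τ₊^{s} ( V(r) + λ/r² ) u², X₋(u) = (1/2) τ₊^{s} (∇₊u)² + (1/2) τ₋^{s} ( V(r) + λ/r² ) u², ρ = τ₊^{s} − τ₋^{s} − s r ( τ₊^{s−1} + τ₋^{s−1} ), and 𝔕 = − (τ₊^{s} − τ₋^{s}) ( r V′(r) + 2 V(r) ) / (2r) + ρ V(r)/r + ρ λ/r³. Then at every point of Ω where τ₋ > 0 one has the pointwise identity M(u) · ( ∂_t² u − ∂_r² u + ( V(r) + λ/r² ) u ) = (∂_t + ∂_r) X₊(u) + (∂_t − ∂_r) X₋(u) + 𝔕 u². -/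

import Mathlib

open Set

/-- Partial derivative in the first (time) variable. -/
noncomputable def pderivT (F : ℝ → ℝ → ℝ) (t r : ℝ) : ℝ := deriv (fun τ => F τ r) t

/-- Partial derivative in the second (radial) variable. -/
noncomputable def pderivR (F : ℝ → ℝ → ℝ) (t r : ℝ) : ℝ := deriv (fun ρ => F t ρ) r

/-- `ρ(t,r) = τ₊^s - τ₋^s - s r (τ₊^{s-1} + τ₋^{s-1})`, `τ± = 2+t±r`. -/
noncomputable def rhoWeight (s t r : ℝ) : ℝ :=
  (2 + t + r) ^ s - (2 + t - r) ^ s -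
    s * r * ((2 + t + r) ^ (s - 1) + (2 + t - r) ^ (s - 1))

/-- Partial derivative in the first variable as a directional Fréchet derivative. -/
lemma HasFDerivAt.hasDerivAt_curry_fst {F : ℝ → ℝ → ℝ} {F' : ℝ × ℝ →L[ℝ] ℝ} {t r : ℝ}
    (h : HasFDerivAt (fun p : ℝ × ℝ => F p.1 p.2) F' (t, r)) :
    HasDerivAt (fun τ => F τ r) (F' (1, 0)) t :=
  h.comp_hasDerivAt (f := fun τ : ℝ => (τ, r)) t ((hasDerivAt_id t).prodMk (hasDerivAt_const t r))

/-- Partial derivative in the second variable as a directional Fréchet derivative. -/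
lemma HasFDerivAt.hasDerivAt_curry_snd {F : ℝ → ℝ → ℝ} {F' : ℝ × ℝ →L[ℝ] ℝ} {t r : ℝ}
    (h : HasFDerivAt (fun p : ℝ × ℝ => F p.1 p.2) F' (t, r)) :
    HasDerivAt (fun ρ => F t ρ) (F' (0, 1)) r :=
  h.comp_hasDerivAt (f := fun ρ : ℝ => (t, ρ)) r ((hasDerivAt_const r t).prodMk (hasDerivAt_id r))

/-- The first-order partial derivatives of a `C²` function are differentiable, with derivatives
given by the second Fréchet derivative. -/
lemma hasFDerivAt_pderiv {u : ℝ → ℝ → ℝ} {t r : ℝ}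
    (hu : ContDiffAt ℝ 2 (fun p : ℝ × ℝ => u p.1 p.2) (t, r)) :
    HasFDerivAt (fun p : ℝ × ℝ => pderivT u p.1 p.2)
        ((fderiv ℝ (fderiv ℝ fun p : ℝ × ℝ => u p.1 p.2) (t, r)).flip (1, 0)) (t, r) ∧
      HasFDerivAt (fun p : ℝ × ℝ => pderivR u p.1 p.2)
        ((fderiv ℝ (fderiv ℝ fun p : ℝ × ℝ => u p.1 p.2) (t, r)).flip (0, 1)) (t, r) := by
  have hd : ∀ᶠ p in nhds (t, r), DifferentiableAt ℝ (fun p : ℝ × ℝ => u p.1 p.2) p :=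
    (hu.eventually (by simp)).mono fun p hp => hp.differentiableAt (by norm_num)
  have h2 : HasFDerivAt (fderiv ℝ fun p : ℝ × ℝ => u p.1 p.2)
      (fderiv ℝ (fderiv ℝ fun p : ℝ × ℝ => u p.1 p.2) (t, r)) (t, r) :=
    ((hu.fderiv_right (m := 1) (by norm_num)).differentiableAt (by norm_num)).hasFDerivAt
  have happ (v : ℝ × ℝ) :
      HasFDerivAt (fun p => fderiv ℝ (fun p : ℝ × ℝ => u p.1 p.2) p v)
        ((fderiv ℝ (fderiv ℝ fun p : ℝ × ℝ => u p.1 p.2) (t, r)).flip v) (t, r) := by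
    simpa using h2.clm_apply (hasFDerivAt_const v (t, r))
  constructor
  · refine (happ (1, 0)).congr_of_eventuallyEq (hd.mono fun p hp => ?_)
    exact hp.hasFDerivAt.hasDerivAt_curry_fst.deriv
  · refine (happ (0, 1)).congr_of_eventuallyEq (hd.mono fun p hp => ?_)
    exact hp.hasFDerivAt.hasDerivAt_curry_snd.deriv

/-- The multiplier identity of Lemma 4.1: with
`M(u) = τ₊^s ∇₊u + τ₋^s ∇₋u`, `∇±u = ∂_t u ± ∂_r u`,
`X₊(u) = ½ τ₋^s (∇₋u)² + ½ τ₊^s (V + λ/r²) u²`,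
`X₋(u) = ½ τ₊^s (∇₊u)² + ½ τ₋^s (V + λ/r²) u²`, and
`𝔕 = -(τ₊^s - τ₋^s)(rV' + 2V)/(2r) + ρ V/r + ρ λ/r³`, one has, at every point of an
open set `Ω ⊆ ℝ × (0,∞)` where `τ₋ > 0`,
`M(u)(∂_t²u - ∂_r²u + (V + λ/r²)u) = (∂_t+∂_r)X₊(u) + (∂_t-∂_r)X₋(u) + 𝔕 u²`. -/
theorem stmt_11 (s lam : ℝ) (hs : 0 ≤ s) (V : ℝ → ℝ)
    (hV : ContDiffOn ℝ 1 V (Ioi (0 : ℝ)))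
    (Ω : Set (ℝ × ℝ)) (hΩ : IsOpen Ω) (hΩ' : Ω ⊆ (univ : Set ℝ) ×ˢ Ioi (0 : ℝ))
    (u : ℝ → ℝ → ℝ) (hu : ContDiffOn ℝ 2 (fun p : ℝ × ℝ => u p.1 p.2) Ω) :
    ∀ t r : ℝ, (t, r) ∈ Ω → 0 < 2 + t - r →
      (let Xp : ℝ → ℝ → ℝ := fun t r =>
        (1 / 2) * (2 + t - r) ^ s * (pderivT u t r - pderivR u t r) ^ 2 +
          (1 / 2) * (2 + t + r) ^ s * (V r + lam / r ^ 2) * (u t r) ^ 2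
      let Xm : ℝ → ℝ → ℝ := fun t r =>
        (1 / 2) * (2 + t + r) ^ s * (pderivT u t r + pderivR u t r) ^ 2 +
          (1 / 2) * (2 + t - r) ^ s * (V r + lam / r ^ 2) * (u t r) ^ 2
      let frakS : ℝ := -(((2 + t + r) ^ s - (2 + t - r) ^ s) *
            (r * deriv V r + 2 * V r)) / (2 * r) +
          rhoWeight s t r * V r / r + rhoWeight s t r * lam / r ^ 3
      ((2 + t + r) ^ s * (pderivT u t r + pderivR u t r) +
          (2 + t - r) ^ s * (pderivT u t r - pderivR u t r)) *
        (pderivT (pderivT u) t r - pderivR (pderivR u) t r +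
          (V r + lam / r ^ 2) * u t r) =
        (pderivT Xp t r + pderivR Xp t r) + (pderivT Xm t r - pderivR Xm t r) +
          frakS * (u t r) ^ 2) := by
  intro t r htr hm Xp Xm frakS
  have hr : 0 < r := (hΩ' htr).2
  have hp : 0 < 2 + t + r := by linarith
  have hu' : ContDiffAt ℝ 2 (fun p : ℝ × ℝ => u p.1 p.2) (t, r) :=
    hu.contDiffAt (hΩ.mem_nhds htr)
  have hsymm : IsSymmSndFDerivAt ℝ (fun p : ℝ × ℝ => u p.1 p.2) (t, r) :=
    hu'.isSymmSndFDerivAt (by simp)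
  have hmix := hsymm.eq (1, 0) (0, 1)
  obtain ⟨hT, hR⟩ := hasFDerivAt_pderiv hu'
  have hTT := hT.hasDerivAt_curry_fst
  have hTR := hT.hasDerivAt_curry_snd
  have hRT := hR.hasDerivAt_curry_fst
  have hRR := hR.hasDerivAt_curry_snd
  simp only [ContinuousLinearMap.flip_apply] at hTT hTR hRT hRR
  have hu1 := (hu'.differentiableAt (by norm_num)).hasFDerivAt
  have huT : HasDerivAt (fun τ => u τ r) (pderivT u t r) t :=
    hu1.hasDerivAt_curry_fst.differentiableAt.hasDerivAt
  have huR : HasDerivAt (fun ρ => u t ρ) (pderivR u t r) r :=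
    hu1.hasDerivAt_curry_snd.differentiableAt.hasDerivAt
  have hVr : HasDerivAt V (deriv V r) r :=
    ((hV.contDiffAt (Ioi_mem_nhds hr)).differentiableAt (by norm_num)).hasDerivAt
  have hW : HasDerivAt (fun ρ => V ρ + lam / ρ ^ 2) (deriv V r - 2 * lam / r ^ 3) r := by
    refine (hVr.add ((hasDerivAt_const r lam).div (hasDerivAt_pow 2 r)
      (by positivity))).congr_deriv ?_
    field_simp
    norm_num
    ring
  have hpT : HasDerivAt (fun τ => (2 + τ + r) ^ s) (s * (2 + t + r) ^ (s - 1)) t := by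
    simpa using (((hasDerivAt_id t).const_add 2).add_const r).rpow_const (p := s) (.inl hp.ne')
  have hmT : HasDerivAt (fun τ => (2 + τ - r) ^ s) (s * (2 + t - r) ^ (s - 1)) t := by
    simpa using (((hasDerivAt_id t).const_add 2).sub_const r).rpow_const (p := s) (.inl hm.ne')
  have hpR : HasDerivAt (fun ρ => (2 + t + ρ) ^ s) (s * (2 + t + r) ^ (s - 1)) r := by
    simpa using ((hasDerivAt_id r).const_add (2 + t)).rpow_const (p := s) (.inl hp.ne')
  have hmR : HasDerivAt (fun ρ => (2 + t - ρ) ^ s) (-(s * (2 + t - r) ^ (s - 1))) r := by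
    simpa using ((hasDerivAt_id r).const_sub (2 + t)).rpow_const (p := s) (.inl hm.ne')
  have eXpT : pderivT Xp t r = _ :=
    (((hmT.const_mul (1 / 2)).mul ((hTT.sub hRT).pow 2)).add
      (((hpT.const_mul (1 / 2)).mul_const (V r + lam / r ^ 2)).mul (huT.pow 2))).deriv
  have eXpR : pderivR Xp t r = _ :=
    (((hmR.const_mul (1 / 2)).mul ((hTR.sub hRR).pow 2)).add
      (((hpR.const_mul (1 / 2)).mul hW).mul (huR.pow 2))).deriv
  have eXmT : pderivT Xm t r = _ :=
    (((hpT.const_mul (1 / 2)).mul ((hTT.add hRT).pow 2)).add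
      (((hmT.const_mul (1 / 2)).mul_const (V r + lam / r ^ 2)).mul (huT.pow 2))).deriv
  have eXmR : pderivR Xm t r = _ :=
    (((hpR.const_mul (1 / 2)).mul ((hTR.add hRR).pow 2)).add
      (((hmR.const_mul (1 / 2)).mul hW).mul (huR.pow 2))).deriv
  have eTT : pderivT (pderivT u) t r = _ := hTT.deriv
  have eRR : pderivR (pderivR u) t r = _ := hRR.deriv
  rw [eXpT, eXpR, eXmT, eXmR, eTT, eRR, hmix]
  simp only [frakS, rhoWeight, Pi.add_apply, Pi.sub_apply, Pi.mul_apply, Pi.pow_apply]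
  field_simp
  ring
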